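/- Let X be a set and k : X → X → ℂ a PSD kernel with k(x,y) ≠ 0 for all x, y ∈ X. If k has the complete Pick property, then for every z ∈ X the kernel F_z(x,y) := 1 − (k(x,z) * k(z,y)) / (k(z,z) * k(x,y)) is PSD, i.e., for every n ∈ ℕ and every tuple x : Fin n → X the matrix (F_z (x i) (x j))_{i,j} is positive semidefinite. -/

import Mathlib

open ComplexOrder Matrix

/-- A kernel `k : X → X → ℂ` is positive semidefinite if for every finite tuple of points the
associated Gram-type matrix is positive semidefinite. -/
def IsPSDKernel {X : Type*} (k : X → X → ℂ) : Prop :=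
  ∀ (n : ℕ) (x : Fin n → X), (Matrix.of fun i j : Fin n => k (x i) (x j)).PosSemidef

/-- Given `W : X → Matrix (Fin s) (Fin t) ℂ`, the operator-valued kernel `(1 - W W*) k` is PSD:
for every tuple `x : Fin n → X`, the block matrix with `((i,a),(j,b))` entry
`k (x i) (x j) * ((1 - W (x i) * (W (x j))ᴴ) a b)` is positive semidefinite. -/
def MultKernelPSD {X : Type*} (k : X → X → ℂ) {s t : ℕ}
    (W : X → Matrix (Fin s) (Fin t) ℂ) : Prop :=
  ∀ (n : ℕ) (x : Fin n → X),
    (Matrix.of fun p q : Fin n × Fin s =>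
      k (x p.1) (x q.1) *
        ((1 : Matrix (Fin s) (Fin s) ℂ) - W (x p.1) * (W (x q.1))ᴴ) p.2 q.2).PosSemidef

/-- The kernel `k` has the complete Pick property (matrix formulation): for all `s t : ℕ`, every
finite subset `S ⊆ X` and every `W : X → Matrix (Fin s) (Fin t) ℂ` such that `(1 - W W*) k` is
PSD on tuples of points from `S`, there is a `Φ : X → Matrix (Fin s) (Fin t) ℂ` agreeing with
`W` on `S` such that `(1 - Φ Φ*) k` is PSD on all of `X`. -/
def CompletePickProperty {X : Type*} (k : X → X → ℂ) : Prop :=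
  ∀ (s t : ℕ) (S : Finset X) (W : X → Matrix (Fin s) (Fin t) ℂ),
    (∀ (n : ℕ) (x : Fin n → X), (∀ i, x i ∈ S) →
      (Matrix.of fun p q : Fin n × Fin s =>
        k (x p.1) (x q.1) *
          ((1 : Matrix (Fin s) (Fin s) ℂ) - W (x p.1) * (W (x q.1))ᴴ) p.2 q.2).PosSemidef) →
    ∃ Φ : X → Matrix (Fin s) (Fin t) ℂ, (∀ x ∈ S, Φ x = W x) ∧ MultKernelPSD k Φ

/-- The kernel `1 - k(x,z) k(z,y) / (k(z,z) k(x,y))`. -/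
noncomputable def pickDefect {X : Type*} (k : X → X → ℂ) (z x y : X) : ℂ :=
  1 - (k x z * k z y) / (k z z * k x y)

namespace IsPSDKernel

variable {X : Type*} {k : X → X → ℂ}

theorem star_apply (hk : IsPSDKernel k) (x y : X) : star (k x y) = k y x := by
  simpa using (hk 2 ![x, y]).isHermitian.apply 1 0

theorem diag_nonneg (hk : IsPSDKernel k) (x : X) : 0 ≤ k x x := by
  simpa using (hk 1 ![x]).diag_nonneg (i := 0)

/-- The rank-one kernel `k(x,a) k(a,y) / k(a,a)` is positive semidefinite. -/
theorem posSemidef_rankOne (hk : IsPSDKernel k) (a : X) {ι : Type*} [Finite ι] (x : ι → X) :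
    (Matrix.of fun i j => k (x i) a * k a (x j) / k a a).PosSemidef := by
  have h := (Matrix.posSemidef_vecMulVec_self_star fun i => k (x i) a).smul
    (inv_nonneg.2 (hk.diag_nonneg a))
  convert h using 1
  ext i j
  simp only [Matrix.of_apply, Matrix.smul_apply, Matrix.vecMulVec_apply, Pi.star_apply,
    hk.star_apply, smul_eq_mul]
  ring

end IsPSDKernel

namespace MultKernelPSD

variable {X : Type*} {k : X → X → ℂ} {t : ℕ} {Φ : X → Matrix (Fin 1) (Fin t) ℂ}

theorem posSemidef_row (hΦ : MultKernelPSD k Φ) {ι : Type*} [Finite ι] (x : ι → X) :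
    (Matrix.of fun i j => k (x i) (x j) * (1 - (Φ (x i) * (Φ (x j))ᴴ) 0 0)).PosSemidef := by
  have := Fintype.ofFinite ι
  have h := (hΦ (Fintype.card ι) (x ∘ (Fintype.equivFin ι).symm)).submatrix
    fun i => (Fintype.equivFin ι i, (0 : Fin 1))
  convert h using 1
  ext i j
  simp

/-- A contractive row multiplier stays contractive on the functions vanishing at `z`. -/
theorem posSemidef_mul_pickDefect (hk : IsPSDKernel k) (hnz : ∀ x y : X, k x y ≠ 0)
    (hΦ : MultKernelPSD k Φ) (z : X) {ι : Type*} [Finite ι] (x : ι → X) :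
    (Matrix.of fun i j => k (x i) (x j) * pickDefect k z (x i) (x j) *
      (1 - (Φ (x i) * (Φ (x j))ᴴ) 0 0)).PosSemidef := by
  have := Fintype.ofFinite ι
  have := Classical.decEq ι
  let y : Unit ⊕ ι → X := Sum.elim (fun _ => z) x
  let V : Matrix (Unit ⊕ ι) (Fin t) ℂ := Matrix.of fun p l => k (y p) z * Φ (y p) 0 l
  have hV := (Matrix.posSemidef_self_mul_conjTranspose V).smul (inv_nonneg.2 (hk.diag_nonneg z))
  have hsum := (hΦ.posSemidef_row y).add hV
  have hentry : ∀ p q, (V * Vᴴ) p q = k (y p) z * k z (y q) * (Φ (y p) * (Φ (y q))ᴴ) 0 0 := by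
    intro p q
    simp only [V, Matrix.mul_apply, Matrix.conjTranspose_apply, Matrix.of_apply, star_mul',
      hk.star_apply, Finset.mul_sum]
    exact Finset.sum_congr rfl fun _ _ => by ring
  let A : Matrix Unit Unit ℂ := Matrix.diagonal fun _ => k z z
  let B : Matrix Unit ι ℂ := Matrix.of fun _ j => k z (x j)
  let D : Matrix ι ι ℂ := Matrix.of fun i j => k (x i) (x j) -
    k (x i) (x j) * pickDefect k z (x i) (x j) * (Φ (x i) * (Φ (x j))ᴴ) 0 0
  have hA : A.PosDef :=
    Matrix.PosDef.diagonal fun _ => lt_of_le_of_ne (hk.diag_nonneg z) (hnz z z).symm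
  have : Invertible A := hA.isUnit.invertible
  have hblock : (Matrix.fromBlocks A B Bᴴ D).PosSemidef := by
    convert hsum using 1
    ext p q
    have hz := hnz z z
    rcases p with p | i <;> rcases q with q | j <;>
      simp only [Matrix.fromBlocks_apply₁₁, Matrix.fromBlocks_apply₁₂, Matrix.fromBlocks_apply₂₁,
        Matrix.fromBlocks_apply₂₂, Matrix.add_apply, Matrix.smul_apply, hentry, smul_eq_mul,
        Matrix.of_apply, Matrix.conjTranspose_apply, hk.star_apply, y, Sum.elim_inl, Sum.elim_inr,
        A, B, D, Matrix.diagonal_apply_eq]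
    · field_simp
      ring
    · field_simp
      ring
    · field_simp
      ring
    · have := hnz (x i) (x j)
      simp only [pickDefect]
      field_simp
      ring
  have hschur := (hA.fromBlocks₁₁ B D).1 hblock
  have hAinv : A⁻¹ = Matrix.diagonal fun _ => (k z z)⁻¹ := by
    refine Matrix.inv_eq_right_inv ?_
    simp [A, Matrix.diagonal_mul_diagonal, hnz z z]
  refine Eq.subst (motive := Matrix.PosSemidef) ?_ hschur
  ext i j
  have hz := hnz z z
  have hij := hnz (x i) (x j)
  simp only [hAinv, Matrix.sub_apply, Matrix.mul_apply, Matrix.diagonal_apply_eq, Finset.univ_unique,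
    Finset.sum_singleton, Matrix.conjTranspose_apply, B, D, Matrix.of_apply, hk.star_apply,
    pickDefect]
  field_simp
  ring

end MultKernelPSD

open scoped MatrixOrder in
/-- A positive semidefinite factorization of the defect kernel based at `a` over a finite set `S`
extends to `insert a S`. -/
theorem exists_row_factorization_pickDefect {X : Type*} {k : X → X → ℂ}
    (hnz : ∀ x y : X, k x y ≠ 0) (a : X) (S : Finset X) (ha : a ∉ S)
    (h : (Matrix.of fun i j : S => pickDefect k a i j).PosSemidef) :
    ∃ (t : ℕ) (W : X → Matrix (Fin 1) (Fin t) ℂ), ∀ x y, (x = a ∨ x ∈ S) → (y = a ∨ y ∈ S) →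
      (W x * (W y)ᴴ) 0 0 = pickDefect k a x y := by
  classical
  obtain ⟨B, hB⟩ := CStarAlgebra.nonneg_iff_eq_star_mul_self.1 h.nonneg
  rw [Matrix.star_eq_conjTranspose] at hB
  let e := Fintype.equivFin S
  let W : X → Matrix (Fin 1) (Fin (Fintype.card S)) ℂ := fun x =>
    Matrix.of fun _ l => if hx : x ∈ S then star (B (e.symm l) ⟨x, hx⟩) else 0
  have hleft : ∀ y, pickDefect k a a y = 0 := fun y => by
    simp [pickDefect, hnz]
  have hright : ∀ x, pickDefect k a x a = 0 := fun x => by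
    rw [pickDefect, mul_comm (k x a), div_self (mul_ne_zero (hnz _ _) (hnz _ _)), sub_self]
  refine ⟨_, W, ?_⟩
  rintro x y (rfl | hx) (rfl | hy)
  · simp [W, ha, hleft, Matrix.mul_apply]
  · simp [W, ha, hleft, Matrix.mul_apply]
  · simp [W, ha, hright, Matrix.mul_apply]
  · have hxy := congr_fun₂ hB ⟨x, hx⟩ ⟨y, hy⟩
    simp only [Matrix.of_apply, Matrix.mul_apply, Matrix.conjTranspose_apply] at hxy
    rw [hxy, ← e.symm.sum_comp]
    simp [W, hx, hy, Matrix.mul_apply]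

/-- If the defect kernel based at `a` has a row factorization over `S`, then the complete Pick
property makes the defect kernel based at any `z` positive semidefinite over `S`. -/
theorem CompletePickProperty.posSemidef_pickDefect_of_factorization {X : Type*} {k : X → X → ℂ}
    (hcp : CompletePickProperty k) (hk : IsPSDKernel k) (hnz : ∀ x y : X, k x y ≠ 0)
    (a z : X) (S : Finset X) {t : ℕ} (W : X → Matrix (Fin 1) (Fin t) ℂ)
    (hW : ∀ x ∈ S, ∀ y ∈ S, (W x * (W y)ᴴ) 0 0 = pickDefect k a x y) :
    (Matrix.of fun i j : S => pickDefect k z i j).PosSemidef := by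
  classical
  obtain ⟨Φ, hΦW, hΦ⟩ := hcp 1 t S W fun n x hx => by
    convert hk.posSemidef_rankOne a (fun p : Fin n × Fin 1 => x p.1) using 1
    ext ⟨i, r⟩ ⟨j, s⟩
    have hij := hnz (x i) (x j)
    have haa := hnz a a
    rw [Subsingleton.elim r 0, Subsingleton.elim s 0]
    simp only [Matrix.of_apply, Matrix.sub_apply, Matrix.one_apply_eq, hW _ (hx i) _ (hx j),
      pickDefect]
    field_simp
    ring
  have h := (hΦ.posSemidef_mul_pickDefect hk hnz z fun i : S => (i : X)).mul_mul_conjTranspose_same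
    (Matrix.diagonal fun i : S => (k i a)⁻¹)
  convert h.smul (hk.diag_nonneg a) using 1
  ext i j
  have hij := hnz i j
  have haa := hnz a a
  have hia := hnz i a
  have haj := hnz a j
  have hstar : star (k j a)⁻¹ = (k a j)⁻¹ := by rw [star_inv₀, hk.star_apply]
  simp only [Matrix.diagonal_conjTranspose, Matrix.smul_apply, Matrix.mul_diagonal,
    Matrix.diagonal_mul, Matrix.of_apply, Pi.star_apply, hstar, hΦW _ i.2, hΦW _ j.2,
    hW _ i.2 _ j.2, smul_eq_mul]
  rw [show 1 - pickDefect k a i j = k i a * k a j / (k a a * k i j) by simp [pickDefect]]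
  field_simp

theorem CompletePickProperty.posSemidef_pickDefect {X : Type*} {k : X → X → ℂ}
    (hcp : CompletePickProperty k) (hk : IsPSDKernel k) (hnz : ∀ x y : X, k x y ≠ 0)
    (S : Finset X) : ∀ z, (Matrix.of fun i j : S => pickDefect k z i j).PosSemidef := by
  classical
  induction S using Finset.induction_on with
  | empty =>
    intro z
    convert Matrix.PosSemidef.zero
    exact Subsingleton.elim _ _
  | insert a S ha ih =>
    intro z
    obtain ⟨t, W, hW⟩ := exists_row_factorization_pickDefect hnz a S ha (ih a)
    exact hcp.posSemidef_pickDefect_of_factorization hk hnz a z _ W fun x hx y hy =>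
      hW x y (Finset.mem_insert.1 hx) (Finset.mem_insert.1 hy)

/-- **Necessity in the McCullough–Quiggin theorem.** If a non-vanishing PSD kernel `k` has the
complete Pick property, then for every `z` the kernel
`F_z(x,y) = 1 - k(x,z) k(z,y) / (k(z,z) k(x,y))` is PSD. -/
theorem necessity_complete_pick {X : Type*} (k : X → X → ℂ)
    (hpsd : IsPSDKernel k)
    (hnz : ∀ x y : X, k x y ≠ 0)
    (hcp : CompletePickProperty k) :
    ∀ z : X, ∀ (n : ℕ) (x : Fin n → X),
      (Matrix.of fun i j : Fin n =>
        1 - (k (x i) z * k z (x j)) / (k z z * k (x i) (x j))).PosSemidef := by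
  classical
  intro z n x
  exact (hcp.posSemidef_pickDefect hpsd hnz (Finset.univ.image x) z).submatrix
    fun i => ⟨x i, Finset.mem_image_of_mem x (Finset.mem_univ i)⟩
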